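/- arXiv:2603.12197 — 2 statements merged into one kernel-verified Lean document; each statement's English description precedes it below -/
import Mathlib

section
/- Suppose d is odd. If w₁ and w₂ are nonempty words over 𝒳, each formed out of commuting products, such that for every generator x ∈ 𝒳 the number of occurrences of x in w₁ is congruent modulo d to the number of occurrences of x in w₂, then Σ𝒮(w₁) = Σ𝒮(w₂) in ℤ_d. -/
/-- `Σ𝒮(s)`: the sum over inversions of the word `s`. -/
def invSum (n d : ℕ) (μ : Fin n → Fin n → ZMod d) : List (Fin n) → ZMod d
  | [] => 0
  | x :: s => (s.map (fun y => if y < x then μ x y else 0)).sum + invSum n d μ s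

/-- `Σ𝒮(s,t)`: the sum over inversions between `s` and `t`. -/
def invSum2 (n d : ℕ) (μ : Fin n → Fin n → ZMod d) (s t : List (Fin n)) : ZMod d :=
  (s.map (fun x => (t.map (fun y => if y < x then μ x y else 0)).sum)).sum

/-- The formal commutator `⟦s,t⟧ := Σ𝒮(s,t) − Σ𝒮(t,s)`. -/
def fcomm (n d : ℕ) (μ : Fin n → Fin n → ZMod d) (s t : List (Fin n)) : ZMod d :=
  invSum2 n d μ s t - invSum2 n d μ t s

/-- Bracketings: binary trees with leaves labelled by generators. -/
inductive Brack (n : ℕ) : Type where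
  | leaf : Fin n → Brack n
  | node : Brack n → Brack n → Brack n

/-- `∂(β)`: the word of leaf labels of a bracketing. -/
def Brack.word {n : ℕ} : Brack n → List (Fin n)
  | .leaf x => [x]
  | .node b₁ b₂ => b₁.word ++ b₂.word

/-- A bracketing witnesses commuting products if `⟦∂(β₁), ∂(β₂)⟧ = 0` at every internal node. -/
def Brack.Ok (n d : ℕ) (μ : Fin n → Fin n → ZMod d) : Brack n → Prop
  | .leaf _ => True
  | .node b₁ b₂ =>
      fcomm n d μ b₁.word b₂.word = 0 ∧ Brack.Ok n d μ b₁ ∧ Brack.Ok n d μ b₂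

/-- `w` is formed out of commuting products. -/
def Commuting (n d : ℕ) (μ : Fin n → Fin n → ZMod d) (w : List (Fin n)) : Prop :=
  ∃ β : Brack n, Brack.Ok n d μ β ∧ β.word = w

theorem sum_map_eq_sum_count {n d : ℕ} (f : Fin n → ZMod d) (s : List (Fin n)) :
    (s.map f).sum = ∑ x, (s.count x : ZMod d) * f x := by
  induction s with
  | nil => simp
  | cons a s ih =>
    simp [ih, List.count_cons, add_mul, Finset.sum_add_distrib, add_comm]

/-- The map `invSum2` depends only on the occurrence counts modulo `d`. -/
theorem invSum2_congr {n d : ℕ} (μ : Fin n → Fin n → ZMod d) {s s' t t' : List (Fin n)}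
    (hs : ∀ x, (s.count x : ZMod d) = s'.count x) (ht : ∀ x, (t.count x : ZMod d) = t'.count x) :
    invSum2 n d μ s t = invSum2 n d μ s' t' := by
  simp only [invSum2, sum_map_eq_sum_count, hs, ht]

theorem invSum2_append_left {n d : ℕ} (μ : Fin n → Fin n → ZMod d) (s s' t : List (Fin n)) :
    invSum2 n d μ (s ++ s') t = invSum2 n d μ s t + invSum2 n d μ s' t := by
  simp [invSum2]

theorem invSum2_append_right {n d : ℕ} (μ : Fin n → Fin n → ZMod d) (s t t' : List (Fin n)) :
    invSum2 n d μ s (t ++ t') = invSum2 n d μ s t + invSum2 n d μ s t' := by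
  simp [invSum2, List.sum_map_add]

theorem invSum_append {n d : ℕ} (μ : Fin n → Fin n → ZMod d) (s t : List (Fin n)) :
    invSum n d μ (s ++ t) = invSum n d μ s + invSum n d μ t + invSum2 n d μ s t := by
  induction s with
  | nil => simp [invSum, invSum2]
  | cons a s ih =>
    simp only [invSum2] at ih
    simp only [List.cons_append, invSum, invSum2, ih, List.map_append, List.sum_append,
      List.map_cons, List.sum_cons]
    ring

/-- Twice the inversion sum of a commuting product is the associated quadratic form. -/
theorem Brack.Ok.two_mul_invSum {n d : ℕ} {μ : Fin n → Fin n → ZMod d} {β : Brack n}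
    (h : β.Ok n d μ) : 2 * invSum n d μ β.word = invSum2 n d μ β.word β.word := by
  induction β with
  | leaf x => simp [Brack.word, invSum, invSum2]
  | node b₁ b₂ ih₁ ih₂ =>
    obtain ⟨hc, h₁, h₂⟩ := h
    rw [fcomm] at hc
    simp only [Brack.word, invSum_append, invSum2_append_left, invSum2_append_right]
    linear_combination ih₁ h₁ + ih₂ h₂ + hc

theorem stmt12 (n d : ℕ) (hd : 2 ≤ d) (hodd : Odd d) (μ : Fin n → Fin n → ZMod d)
    (hskew : ∀ x y, μ x y = - μ y x) (hdiag : ∀ x, μ x x = 0) :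
    ∀ w₁ w₂ : List (Fin n), w₁ ≠ [] → w₂ ≠ [] →
      Commuting n d μ w₁ → Commuting n d μ w₂ →
      (∀ x : Fin n, (w₁.count x : ZMod d) = (w₂.count x : ZMod d)) →
      invSum n d μ w₁ = invSum n d μ w₂ := by
  rintro _ _ - - ⟨β₁, h₁, rfl⟩ ⟨β₂, h₂, rfl⟩ hcount
  have h2 : IsUnit (2 : ZMod d) := by
    exact_mod_cast (ZMod.isUnit_iff_coprime 2 d).2 hodd.coprime_two_left
  apply h2.mul_left_cancel
  rw [h₁.two_mul_invSum, h₂.two_mul_invSum]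
  exact invSum2_congr μ hcount hcount
end

section
/- If d is odd, then for every commutator matrix μ over ℤ_d there exists a non-contextual value assignment l : C(μ) → ℤ_d. -/
/-- A contextual word for μ. -/
def ContextualWord (n d : ℕ) (μ : Fin n → Fin n → ZMod d) (w : List (Fin n)) : Prop :=
  w ≠ [] ∧ (∀ x : Fin n, d ∣ w.count x) ∧ Commuting n d μ w ∧ invSum n d μ w ≠ 0

/-- The strictly-lower-triangular pairing `μ̌(k⃗, l⃗) = k⃗ᵀ μ̌ l⃗`. -/
def cPair (n d : ℕ) (μ : Fin n → Fin n → ZMod d) (k l : Fin n → ZMod d) : ZMod d :=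
  ∑ i, ∑ j, if j < i then k i * μ i j * l j else 0

/-- The product of the group H(μ). -/
def Hmul (n d : ℕ) (μ : Fin n → Fin n → ZMod d)
    (g h : ZMod d × (Fin n → ZMod d)) : ZMod d × (Fin n → ZMod d) :=
  (g.1 + h.1 + cPair n d μ g.2 h.2, g.2 + h.2)

/-- C(μ): the smallest subset of H(μ) containing the scalars `(k, 0⃗)` and the
generators `(0, eᵢ)`, closed under products of commuting elements. -/
inductive InC (n d : ℕ) (μ : Fin n → Fin n → ZMod d) : ZMod d × (Fin n → ZMod d) → Prop where
  | scalar (k : ZMod d) : InC n d μ (k, 0)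
  | gen (i : Fin n) : InC n d μ (0, Pi.single i 1)
  | mul {g h : ZMod d × (Fin n → ZMod d)} : InC n d μ g → InC n d μ h →
      Hmul n d μ g h = Hmul n d μ h g → InC n d μ (Hmul n d μ g h)

/-- A non-contextual value assignment on C(μ). -/
def NCVA (n d : ℕ) (μ : Fin n → Fin n → ZMod d)
    (l : ZMod d × (Fin n → ZMod d) → ZMod d) : Prop :=
  (∀ k : ZMod d, l (k, 0) = k) ∧
  ∀ g h : ZMod d × (Fin n → ZMod d), InC n d μ g → InC n d μ h →
    Hmul n d μ g h = Hmul n d μ h g → l (Hmul n d μ g h) = l g + l h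

theorem cPair_add_left (n d : ℕ) (μ : Fin n → Fin n → ZMod d) (k k' l : Fin n → ZMod d) :
    cPair n d μ (k + k') l = cPair n d μ k l + cPair n d μ k' l := by
  simp only [cPair, ← Finset.sum_add_distrib]
  refine Finset.sum_congr rfl fun i _ => Finset.sum_congr rfl fun j _ => ?_
  split_ifs
  · simp only [Pi.add_apply]
    ring
  · simp

theorem cPair_add_right (n d : ℕ) (μ : Fin n → Fin n → ZMod d) (k l l' : Fin n → ZMod d) :
    cPair n d μ k (l + l') = cPair n d μ k l + cPair n d μ k l' := by
  simp only [cPair, ← Finset.sum_add_distrib]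
  refine Finset.sum_congr rfl fun i _ => Finset.sum_congr rfl fun j _ => ?_
  split_ifs
  · simp only [Pi.add_apply]
    ring
  · simp

theorem stmt13 (n d : ℕ) (hn : 1 ≤ n) (hd : 2 ≤ d) (hodd : Odd d)
    (μ : Fin n → Fin n → ZMod d)
    (hskew : ∀ i j, μ i j = - μ j i) (hdiag : ∀ i, μ i i = 0) :
    ∃ l : ZMod d × (Fin n → ZMod d) → ZMod d, NCVA n d μ l := by
  obtain ⟨a, ha⟩ : ∃ a : ZMod d, 2 * a = 1 := by
    obtain ⟨m, hm⟩ := hodd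
    have h : ((2 * m + 1 : ℕ) : ZMod d) = 0 := by rw [← hm, ZMod.natCast_self]
    push_cast at h
    exact ⟨m + 1, by linear_combination h⟩
  refine ⟨fun g => g.1 - a * cPair n d μ g.2 g.2, fun k => by simp [cPair], ?_⟩
  intro g h _ _ hcomm
  have hc : cPair n d μ g.2 h.2 = cPair n d μ h.2 g.2 := by
    have h1 := congrArg Prod.fst hcomm
    simp only [Hmul] at h1
    linear_combination h1
  simp only [Hmul, cPair_add_left, cPair_add_right]
  linear_combination a * hc - cPair n d μ g.2 h.2 * ha
end
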